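/- For every r ≥ 2 there exist two C^∞ diffeomorphisms f, f̄ of [0,1], both infinitely tangent to the identity at 0 and 1, and a bi-Lipschitz homeomorphism φ₀ of [0,1] with φ₀ ∘ f = f̄ ∘ φ₀, such that no C¹ diffeomorphism of [0,1] conjugates f to f̄. -/

import Mathlib

noncomputable def hB (t : ℝ) : ℝ := expNegInvGlue t * expNegInvGlue (1 - t)

lemma hB_smooth : ContDiff ℝ (⊤ : ℕ∞) hB := by
  unfold hB
  exact expNegInvGlue.contDiff.mul (expNegInvGlue.contDiff.comp (contDiff_const.sub contDiff_id))

lemma hB_left {t : ℝ} (h : t ≤ 0) : hB t = 0 := by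
  simp [hB, expNegInvGlue.zero_of_nonpos h]

lemma hB_right {t : ℝ} (h : 1 ≤ t) : hB t = 0 := by
  simp [hB, expNegInvGlue.zero_of_nonpos (show 1 - t ≤ 0 by linarith)]

lemma hB_pos {t : ℝ} (h : 0 < t) (h1 : t < 1) : 0 < hB t :=
  mul_pos (expNegInvGlue.pos_of_pos h) (expNegInvGlue.pos_of_pos (by linarith))

lemma hB_supp : HasCompactSupport hB := by
  refine HasCompactSupport.intro (isCompact_Icc (a := (0:ℝ)) (b := 1)) ?_
  intro x hx
  by_cases h : x ≤ 0
  · exact hB_left h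
  · refine hB_right ?_
    by_contra h2
    exact hx ⟨by linarith, by linarith⟩

lemma hB_it_cont (k : ℕ) : Continuous (iteratedDeriv k hB) :=
  hB_smooth.continuous_iteratedDeriv k (by exact_mod_cast le_top)

lemma hB_bound (k : ℕ) : ∃ C : ℝ, ∀ t, |iteratedDeriv k hB t| ≤ C := by
  obtain ⟨C, hC⟩ := (hB_supp.iteratedFDeriv (𝕜 := ℝ) k).exists_bound_of_continuous
    (hB_smooth.continuous_iteratedFDeriv (by exact_mod_cast le_top))
  refine ⟨C, fun t => ?_⟩
  have := hC t
  rwa [norm_iteratedFDeriv_eq_norm_iteratedDeriv] at this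

lemma hB_flat (k : ℕ) {t : ℝ} (h : t ≤ 0 ∨ 1 ≤ t) : iteratedDeriv k hB t = 0 := by
  have hc : IsClosed {t | iteratedDeriv k hB t = 0} := isClosed_eq (hB_it_cont k) continuous_const
  have key : ∀ s : Set ℝ, IsOpen s → (∀ x ∈ s, hB x = 0) → ∀ x ∈ s, iteratedDeriv k hB x = 0 := by
    intro s hs h0 x hx
    have : hB =ᶠ[nhds x] fun _ => (0:ℝ) := by
      filter_upwards [hs.mem_nhds hx] with y hy using h0 y hy
    rw [this.iteratedDeriv_eq k]
    simp
  rcases h with h | h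
  · have := closure_minimal (key (Set.Iio 0) isOpen_Iio (fun x hx => hB_left (le_of_lt hx))) hc
    rw [closure_Iio] at this
    exact this h
  · have := closure_minimal (key (Set.Ioi 1) isOpen_Ioi (fun x hx => hB_right (le_of_lt hx))) hc
    rw [closure_Ioi] at this
    exact this h

lemma term_it (k : ℕ) (e c p x : ℝ) :
    iteratedDeriv k (fun x => e * hB (c * (x - p))) x = e * (c ^ k * iteratedDeriv k hB (c * (x - p))) := by
  rw [iteratedDeriv_const_mul_field]
  have h1 := congrFun (iteratedDeriv_comp_sub_const (n := k) (f := fun y => hB (c * y)) (s := p)) x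
  rw [h1, iteratedDeriv_comp_const_mul (hB_smooth.of_le (by exact_mod_cast le_top)) c]

lemma exists_g (a e : ℕ → ℝ) (ha : StrictAnti a) (ha0 : a 0 = 1) (hpos : ∀ n, 0 < a n)
    (hl : ∀ n, 1 ≤ 2 ^ (n + 2) * (a n - a (n + 1))) (he : ∀ n, |e n| ≤ 2 / (n.factorial : ℝ)) :
    ∃ g : ℝ → ℝ, ContDiff ℝ (⊤ : ℕ∞) g ∧
      (∀ k, iteratedDeriv k g 0 = 0 ∧ iteratedDeriv k g 1 = 0) ∧
      (∀ n, ∀ x ∈ Set.Icc (a (n+1)) (a n),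
        g x = e n * hB ((x - a (n+1)) / (a n - a (n+1)))) ∧
      ∃ K : ℝ, 0 ≤ K ∧ ∀ x ∈ Set.Icc (0:ℝ) 1, ∀ y ∈ Set.Icc (0:ℝ) 1, |g x - g y| ≤ K * |x - y| := by
  have hlp : ∀ n, 0 < a n - a (n+1) := fun n => sub_pos.2 (ha (Nat.lt_succ_self n))
  let c : ℕ → ℝ := fun n => (a n - a (n+1))⁻¹
  have hcp : ∀ n, 0 < c n := fun n => inv_pos.2 (hlp n)
  have hc : ∀ n, c n ≤ 2 ^ (n+2) := by
    intro n
    rw [inv_le_iff_one_le_mul₀ (hlp n)]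
    linarith [hl n]
  let G : ℕ → ℝ → ℝ := fun n x => e n * hB (c n * (x - a (n+1)))
  have hGs : ∀ n, ContDiff ℝ (⊤ : ℕ∞) (G n) := fun n =>
    contDiff_const.mul (hB_smooth.comp (contDiff_const.mul (contDiff_id.sub contDiff_const)))
  choose C hC using hB_bound
  have hC0 : ∀ k, 0 ≤ C k := fun k => (abs_nonneg _).trans (hC k 0)
  let v : ℕ → ℕ → ℝ := fun k n => (2 * (4 ^ k * C k)) * ((2 ^ k) ^ n / (n.factorial : ℝ))
  have hv : ∀ k : ℕ, (k : ℕ∞) ≤ (⊤ : ℕ∞) → Summable (v k) := fun k _ =>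
    (Real.summable_pow_div_factorial (2 ^ k)).mul_left _
  have hb : ∀ (k : ℕ) (i : ℕ) (x : ℝ), (k : ℕ∞) ≤ (⊤ : ℕ∞) →
      ‖iteratedFDeriv ℝ k (G i) x‖ ≤ v k i := by
    intro k n x _
    rw [norm_iteratedFDeriv_eq_norm_iteratedDeriv, term_it, Real.norm_eq_abs, abs_mul, abs_mul]
    have h1 : |c n ^ k| ≤ (2 ^ (n+2)) ^ k := by
      rw [abs_of_pos (pow_pos (hcp n) k)]
      exact pow_le_pow_left₀ (hcp n).le (hc n) k
    calc _ ≤ (2 / (n.factorial : ℝ)) * ((2 ^ (n+2)) ^ k * C k) := by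
          gcongr
          · exact he n
          · exact hC k _
      _ = v k n := by
          simp only [v]
          have : ((2:ℝ) ^ (n+2)) ^ k = (2 ^ k) ^ n * 4 ^ k := by
            rw [← pow_mul, ← pow_mul, show (4:ℝ) = 2 ^ 2 by norm_num, ← pow_mul, ← pow_add]
            ring_nf
          rw [this]; ring
  have hsm := contDiff_tsum hGs hv hb
  have hflat : ∀ k x, (x ≤ 0 ∨ 1 ≤ x) → iteratedDeriv k (fun x => ∑' n, G n x) x = 0 := by
    intro k x hx
    have hz : ∀ n, iteratedFDeriv ℝ k (G n) x = 0 := by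
      intro n
      rw [← norm_eq_zero, norm_iteratedFDeriv_eq_norm_iteratedDeriv, norm_eq_zero, term_it, hB_flat]
      · simp
      · rcases hx with hx | hx
        · left
          exact mul_nonpos_of_nonneg_of_nonpos (hcp n).le (by linarith [hpos (n+1)])
        · right
          have : a n ≤ 1 := ha0 ▸ ha.antitone (Nat.zero_le n)
          rw [← inv_mul_cancel₀ (hlp n).ne']
          exact mul_le_mul_of_nonneg_left (by linarith) (hcp n).le
    rw [← norm_eq_zero, ← norm_iteratedFDeriv_eq_norm_iteratedDeriv, norm_eq_zero,
      iteratedFDeriv_tsum_apply hGs hv hb le_top]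
    simp [hz]
  refine ⟨fun x => ∑' n, G n x, hsm, fun k => ⟨hflat k 0 (Or.inl le_rfl), hflat k 1 (Or.inr le_rfl)⟩,
    ?_, ?_⟩
  · intro n x hx
    simp only
    rw [tsum_eq_single n]
    · simp only [G, c]; congr 2; rw [div_eq_inv_mul]
    · intro m hm
      simp only [G]
      rcases lt_or_gt_of_ne hm with h | h
      · have : a n ≤ a (m+1) := ha.antitone h
        rw [hB_left, mul_zero]
        exact mul_nonpos_of_nonneg_of_nonpos (hcp m).le (by linarith [hx.2])
      · have : a m ≤ a (n+1) := ha.antitone h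
        rw [hB_right, mul_zero]
        rw [← inv_mul_cancel₀ (hlp m).ne']
        exact mul_le_mul_of_nonneg_left (by linarith [hx.1]) (hcp m).le
  · obtain ⟨K, hK⟩ := (hsm.contDiffOn (s := Set.Icc (0:ℝ) 1)).exists_lipschitzOnWith (by simp)
      (convex_Icc _ _) isCompact_Icc
    refine ⟨K, K.2, fun x hx y hy => ?_⟩
    have := hK.dist_le_mul x hx y hy
    simpa [Real.dist_eq] using this

lemma cover (a : ℕ → ℝ) (ha0 : a 0 = 1) (hlim : Filter.Tendsto a Filter.atTop (nhds 0))
    {x : ℝ} (hx : 0 < x) (hx1 : x ≤ 1) : ∃ n, a (n+1) < x ∧ x ≤ a n := by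
  classical
  have hex : ∃ n, a n < x := (hlim.eventually (gt_mem_nhds hx)).exists
  have h0 : Nat.find hex ≠ 0 := by
    intro h
    have := Nat.find_spec hex
    rw [h, ha0] at this
    linarith
  obtain ⟨m, hm⟩ := Nat.exists_eq_succ_of_ne_zero h0
  refine ⟨m, ?_, ?_⟩
  · have := Nat.find_spec hex
    rwa [hm] at this
  · exact not_lt.1 (Nat.find_min hex (m := m) (by omega))

lemma f_props (a e : ℕ → ℝ) (ha : StrictAnti a) (ha0 : a 0 = 1)
    (hlim : Filter.Tendsto a Filter.atTop (nhds 0)) (he : ∀ n, 0 < e n)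
    (g : ℝ → ℝ) (hg : ContDiff ℝ (⊤ : ℕ∞) g)
    (hflat : ∀ k, iteratedDeriv k g 0 = 0 ∧ iteratedDeriv k g 1 = 0)
    (hloc : ∀ n, ∀ x ∈ Set.Icc (a (n+1)) (a n),
        g x = e n * hB ((x - a (n+1)) / (a n - a (n+1)))) (K δ : ℝ) (hK : 0 ≤ K)
    (hLip : ∀ x ∈ Set.Icc (0:ℝ) 1, ∀ y ∈ Set.Icc (0:ℝ) 1, |g x - g y| ≤ K * |x - y|)
    (hδ : 0 < δ) (hδK : δ * K < 1) (f : ℝ → ℝ) (hf : f = fun x => x + δ * g x) :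
    ContDiff ℝ (⊤ : ℕ∞) f ∧ f 0 = 0 ∧ f 1 = 1 ∧ StrictMonoOn f (Set.Icc 0 1) ∧
    f '' Set.Icc 0 1 = Set.Icc 0 1 ∧ deriv f 0 = 1 ∧ deriv f 1 = 1 ∧
    (∀ m : ℕ, 2 ≤ m → iteratedDeriv m f 0 = 0 ∧ iteratedDeriv m f 1 = 0) ∧
    (∀ x ∈ Set.Ioc (0:ℝ) 1, f x = x ↔ x ∈ Set.range a) := by
  have hs : ContDiff ℝ (⊤ : ℕ∞) f := by
    rw [hf]; exact contDiff_id.add (contDiff_const.mul hg)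
  have h0 : f 0 = 0 := by have := (hflat 0).1; simp at this; simp [hf, this]
  have h1 : f 1 = 1 := by have := (hflat 0).2; simp at this; simp [hf, this]
  have hmono : StrictMonoOn f (Set.Icc 0 1) := by
    intro x hx y hy hxy
    have := hLip x hx y hy
    rw [abs_sub_comm x y, abs_of_pos (sub_pos.2 hxy)] at this
    have h2 := (abs_le.1 this).2
    have h3 := mul_le_mul_of_nonneg_left h2 hδ.le
    have h4 := mul_lt_mul_of_pos_right hδK (sub_pos.2 hxy)
    simp only [hf]
    nlinarith
  have hit : ∀ m : ℕ, 1 ≤ m → ∀ x, iteratedDeriv m f x =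
      (if m = 1 then 1 else 0) + δ * iteratedDeriv m g x := by
    intro m hm x
    have : f = id + (fun x => δ * g x) := by rw [hf]; rfl
    rw [this, iteratedDeriv_add (contDiff_id.contDiffAt)
      ((contDiff_const.mul hg).of_le (by exact_mod_cast le_top)).contDiffAt, iteratedDeriv_id,
      iteratedDeriv_const_mul_field]
    simp [show m ≠ 0 by omega]
  refine ⟨hs, h0, h1, hmono, ?_, ?_, ?_, ?_, ?_⟩
  · apply Set.Subset.antisymm
    · rintro _ ⟨x, hx, rfl⟩
      have h01 := hmono.monotoneOn (Set.left_mem_Icc.2 zero_le_one) hx hx.1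
      have h02 := hmono.monotoneOn hx (Set.right_mem_Icc.2 zero_le_one) hx.2
      rw [h0] at h01
      rw [h1] at h02
      exact ⟨h01, h02⟩
    · have := intermediate_value_Icc (zero_le_one (α := ℝ)) hs.continuous.continuousOn
      rwa [h0, h1] at this
  · rw [← iteratedDeriv_one, hit 1 le_rfl, (hflat 1).1]; simp
  · rw [← iteratedDeriv_one, hit 1 le_rfl, (hflat 1).2]; simp
  · intro m hm
    rw [hit m (by omega), hit m (by omega), (hflat m).1, (hflat m).2]
    simp [show m ≠ 1 by omega]
  · intro x hx
    have e1 : f x = x ↔ g x = 0 := by simp [hf, hδ.ne']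
    rw [e1]
    constructor
    · intro hgx
      obtain ⟨n, hn1, hn2⟩ := cover a ha0 hlim hx.1 hx.2
      refine ⟨n, ?_⟩
      by_contra hne
      have hlt : x < a n := lt_of_le_of_ne hn2 (Ne.symm hne)
      rw [hloc n x ⟨hn1.le, hn2⟩] at hgx
      have hl : 0 < a n - a (n+1) := by linarith
      have := mul_pos (he n) (hB_pos (div_pos (sub_pos.2 hn1) hl)
        ((div_lt_one hl).2 (by linarith)))
      linarith
    · rintro ⟨n, rfl⟩
      have hlt := ha (Nat.lt_succ_self n)
      rw [hloc n _ ⟨hlt.le, le_rfl⟩, div_self (sub_pos.2 hlt).ne', hB_right le_rfl, mul_zero]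

lemma exists_phi (a b σ : ℕ → ℝ) (ha : StrictAnti a) (ha0 : a 0 = 1) (hpos : ∀ n, 0 < a n)
    (hlim : Filter.Tendsto a Filter.atTop (nhds 0))
    (hblim : Filter.Tendsto b Filter.atTop (nhds 0))
    (hσ : ∀ n, σ n = if Even n then 1 / 2 else 2)
    (hab : ∀ n, b n - b (n+1) = σ n * (a n - a (n+1))) :
    ∃ φ : ℝ → ℝ, φ 0 = 0 ∧ Continuous φ ∧
      (∀ n, ∀ x ∈ Set.Icc (a (n+1)) (a n), φ x = b (n+1) + σ n * (x - a (n+1))) ∧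
      (∀ x y, x ≤ y → 1 / 2 * (y - x) ≤ φ y - φ x ∧ φ y - φ x ≤ 2 * (y - x)) := by
  classical
  let S : Set ℝ := ⋃ n : ℕ, ⋃ _ : Even n, Set.Ioc (a (n+1)) (a n)
  have hS : MeasurableSet S :=
    MeasurableSet.iUnion fun n => MeasurableSet.iUnion fun _ => measurableSet_Ioc
  let s : ℝ → ℝ := fun t => if t ∈ S then 1 / 2 else 2
  have hsm : Measurable s := Measurable.ite hS measurable_const measurable_const
  have hs1 : ∀ t, 1 / 2 ≤ s t := fun t => by simp only [s]; split_ifs <;> norm_num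
  have hs2 : ∀ t, s t ≤ 2 := fun t => by simp only [s]; split_ifs <;> norm_num
  have hint : ∀ x y, IntervalIntegrable s MeasureTheory.volume x y := by
    intro x y
    refine (intervalIntegrable_const (c := (2:ℝ))).mono_fun hsm.aestronglyMeasurable ?_
    refine Filter.Eventually.of_forall fun t => ?_
    have h3 : |s t| ≤ 2 := abs_le.2 ⟨by linarith [hs1 t], hs2 t⟩
    simpa using h3
  let φ : ℝ → ℝ := fun x => ∫ t in (0:ℝ)..x, s t
  have hφ : ∀ x y, φ y - φ x = ∫ t in x..y, s t := fun x y =>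
    intervalIntegral.integral_interval_sub_left (hint 0 y) (hint 0 x)
  have hcont : Continuous φ := intervalIntegral.continuous_primitive hint 0
  have hφ0 : φ 0 = 0 := intervalIntegral.integral_same
  have hsn : ∀ n, ∀ t ∈ Set.Ioc (a (n+1)) (a n), s t = σ n := by
    intro n t ht
    have : t ∈ S ↔ Even n := by
      simp only [S, Set.mem_iUnion]
      constructor
      · rintro ⟨m, hm, htm⟩
        have : m = n := by
          rcases lt_trichotomy m n with h | h | h
          · have := ha.antitone (show m + 1 ≤ n from h)
            linarith [ht.2, htm.1]
          · exact h
          · have := ha.antitone (show n + 1 ≤ m from h)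
            linarith [ht.1, htm.2]
        exact this ▸ hm
      · intro h
        exact ⟨n, h, ht⟩
    simp only [s, this, hσ]
  have hloc : ∀ n, ∀ x ∈ Set.Icc (a (n+1)) (a n), φ x - φ (a (n+1)) = σ n * (x - a (n+1)) := by
    intro n x hx
    rw [hφ, intervalIntegral.integral_of_le hx.1,
      MeasureTheory.setIntegral_congr_fun (g := fun _ => σ n) measurableSet_Ioc
        (fun t ht => hsn n t ⟨ht.1, ht.2.trans hx.2⟩),
      ← intervalIntegral.integral_of_le hx.1, intervalIntegral.integral_const, smul_eq_mul, mul_comm]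
  have hconst : ∀ n, φ (a n) - b n = φ (a 0) - b 0 := by
    intro n
    induction n with
    | zero => rfl
    | succ n ih =>
      have := hloc n (a n) ⟨(ha (Nat.lt_succ_self n)).le, le_rfl⟩
      linarith [hab n]
  have hzero : φ (a 0) - b 0 = 0 := by
    have h1 : Filter.Tendsto (fun n => φ (a n) - b n) Filter.atTop (nhds (φ 0 - 0)) :=
      ((hcont.tendsto 0).comp hlim).sub hblim
    simp only [hconst, hφ0, sub_zero] at h1
    exact tendsto_nhds_unique tendsto_const_nhds h1
  refine ⟨φ, hφ0, hcont, ?_, ?_⟩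
  · intro n x hx
    linarith [hloc n x hx, hconst (n+1)]
  · intro x y hxy
    rw [hφ]
    constructor
    · have := intervalIntegral.integral_mono_on hxy (intervalIntegrable_const (c := (1/2:ℝ)))
        (hint x y) (fun t _ => hs1 t)
      rw [intervalIntegral.integral_const, smul_eq_mul] at this
      linarith
    · have := intervalIntegral.integral_mono_on hxy (hint x y)
        (intervalIntegrable_const (c := (2:ℝ))) (fun t _ => hs2 t)
      rw [intervalIntegral.integral_const, smul_eq_mul] at this
      linarith

lemma no_conj (a b : ℕ → ℝ) (f fb ψ : ℝ → ℝ) (ha : StrictAnti a) (hb : StrictAnti b)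
    (hapos : ∀ n, 0 < a n) (hbpos : ∀ n, 0 < b n) (ha0 : a 0 = 1) (hb0 : b 0 = 1)
    (hfa : ∀ x ∈ Set.Ioc (0:ℝ) 1, f x = x ↔ x ∈ Set.range a)
    (hfb : ∀ x ∈ Set.Ioc (0:ℝ) 1, fb x = x ↔ x ∈ Set.range b)
    (hfI : f '' Set.Icc 0 1 = Set.Icc 0 1)
    (hm : StrictMonoOn ψ (Set.Icc 0 1)) (h0 : ψ 0 = 0)
    (him : ψ '' Set.Icc 0 1 = Set.Icc 0 1)
    (hc : ∀ x ∈ Set.Icc (0:ℝ) 1, ψ (f x) = fb (ψ x)) : ∀ n, ψ (a n) = b n := by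
  have ha1 : ∀ n, a n ≤ 1 := fun n => ha0 ▸ ha.antitone (Nat.zero_le n)
  have hb1 : ∀ n, b n ≤ 1 := fun n => hb0 ▸ hb.antitone (Nat.zero_le n)
  have haI : ∀ n, a n ∈ Set.Icc (0:ℝ) 1 := fun n => ⟨(hapos n).le, ha1 n⟩
  have hmem : ∀ x ∈ Set.Icc (0:ℝ) 1, ψ x ∈ Set.Icc (0:ℝ) 1 := fun x hx => him ▸ ⟨x, hx, rfl⟩
  have hr : Set.range (fun n => -ψ (a n)) = Set.range (fun n => - b n) := by
    apply Set.Subset.antisymm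
    · rintro _ ⟨n, rfl⟩
      have h1 : fb (ψ (a n)) = ψ (a n) := by
        rw [← hc _ (haI n), (hfa _ ⟨hapos n, ha1 n⟩).2 ⟨n, rfl⟩]
      have h2 : 0 < ψ (a n) := by
        rw [← h0]; exact hm (Set.left_mem_Icc.2 zero_le_one) (haI n) (hapos n)
      obtain ⟨m, hm'⟩ := (hfb _ ⟨h2, (hmem _ (haI n)).2⟩).1 h1
      exact ⟨m, by simp [hm']⟩
    · rintro _ ⟨n, rfl⟩
      have : b n ∈ ψ '' Set.Icc 0 1 := by rw [him]; exact ⟨(hbpos n).le, hb1 n⟩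
      obtain ⟨x, hx, hxb⟩ := this
      have hx0 : 0 < x := by
        rcases hx.1.eq_or_lt with h | h
        · rw [← h, h0] at hxb
          exact absurd hxb (hbpos n).ne
        · exact h
      have h1 : ψ (f x) = ψ x := by
        rw [hc x hx, hxb, (hfb _ ⟨hbpos n, hb1 n⟩).2 ⟨n, rfl⟩]
      have h2 : f x = x := hm.injOn (hfI ▸ ⟨x, hx, rfl⟩) hx h1
      obtain ⟨m, hm'⟩ := (hfa _ ⟨hx0, hx.2⟩).1 h2
      exact ⟨m, by simp [hm', hxb]⟩
  have s1 : StrictMono (fun n => -ψ (a n)) := fun i j hij =>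
    neg_lt_neg (hm (haI j) (haI i) (ha hij))
  have s2 : StrictMono (fun n => - b n) := fun i j hij => neg_lt_neg (hb hij)
  have := (s1.range_inj s2).1 hr
  intro n
  have := congrFun this n
  simpa using this

/-- **Theorem C, interval version.** There exist two `C^∞` diffeomorphisms `f, f̄` of
`[0,1]`, infinitely tangent to the identity at `0` and `1`, which are conjugated by a
bi-Lipschitz homeomorphism `φ₀` of `[0,1]`, but which are not conjugated by any `C¹`
diffeomorphism of `[0,1]`. -/
theorem stmt12 (r : ℕ) (hr : 2 ≤ r) :
    ∃ f fb φ₀ : ℝ → ℝ,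
      ContDiff ℝ (⊤ : ℕ∞) f ∧ ContDiff ℝ (⊤ : ℕ∞) fb ∧
      f 0 = 0 ∧ f 1 = 1 ∧ fb 0 = 0 ∧ fb 1 = 1 ∧
      StrictMonoOn f (Set.Icc 0 1) ∧ StrictMonoOn fb (Set.Icc 0 1) ∧
      f '' Set.Icc 0 1 = Set.Icc 0 1 ∧ fb '' Set.Icc 0 1 = Set.Icc 0 1 ∧
      -- infinitely tangent to the identity at the endpoints
      deriv f 0 = 1 ∧ deriv f 1 = 1 ∧ deriv fb 0 = 1 ∧ deriv fb 1 = 1 ∧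
      (∀ m : ℕ, 2 ≤ m → iteratedDeriv m f 0 = 0 ∧ iteratedDeriv m f 1 = 0 ∧
        iteratedDeriv m fb 0 = 0 ∧ iteratedDeriv m fb 1 = 0) ∧
      -- φ₀ is a bi-Lipschitz homeomorphism of [0,1] conjugating f to fb
      ContinuousOn φ₀ (Set.Icc 0 1) ∧ StrictMonoOn φ₀ (Set.Icc 0 1) ∧
      φ₀ 0 = 0 ∧ φ₀ 1 = 1 ∧ φ₀ '' Set.Icc 0 1 = Set.Icc 0 1 ∧
      (∃ K : ℝ, 0 < K ∧ ∀ x ∈ Set.Icc (0:ℝ) 1, ∀ y ∈ Set.Icc (0:ℝ) 1,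
        K⁻¹ * |x - y| ≤ |φ₀ x - φ₀ y| ∧ |φ₀ x - φ₀ y| ≤ K * |x - y|) ∧
      (∀ x ∈ Set.Icc (0:ℝ) 1, φ₀ (f x) = fb (φ₀ x)) ∧
      -- but no C¹ diffeomorphism of [0,1] conjugates f to fb
      ¬ ∃ ψ : ℝ → ℝ, ContDiffOn ℝ 1 ψ (Set.Icc 0 1) ∧
        StrictMonoOn ψ (Set.Icc 0 1) ∧ ψ 0 = 0 ∧ ψ 1 = 1 ∧
        ψ '' Set.Icc 0 1 = Set.Icc 0 1 ∧
        (∀ x ∈ Set.Icc (0:ℝ) 1, 0 < derivWithin ψ (Set.Icc 0 1) x) ∧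
        (∀ x ∈ Set.Icc (0:ℝ) 1, ψ (f x) = fb (ψ x)) := by
  let a : ℕ → ℝ := fun n => (1 / 2) ^ n
  let s : ℕ → ℝ := fun n => if Even n then 1 else 3 / 2
  let b : ℕ → ℝ := fun n => s n * (1 / 2) ^ n
  let σ : ℕ → ℝ := fun n => if Even n then 1 / 2 else 2
  have hs : ∀ n, 1 ≤ s n ∧ s n ≤ 3 / 2 := fun n => by
    simp only [s]; split_ifs <;> norm_num
  have hσb : ∀ n, 1 / 2 ≤ σ n ∧ σ n ≤ 2 := fun n => by
    simp only [σ]; split_ifs <;> norm_num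
  have hap : ∀ n, 0 < a n := fun n => by positivity
  have hbp : ∀ n, 0 < b n := fun n => mul_pos (by linarith [(hs n).1]) (hap n)
  have hal : ∀ n, a n - a (n+1) = a (n+1) := fun n => by simp only [a]; ring
  have hab : ∀ n, b n - b (n+1) = σ n * (a n - a (n+1)) := by
    intro n
    rw [hal]
    rcases Nat.even_or_odd n with h | h
    · simp only [a, b, s, σ, h, Nat.even_add_one, not_true, if_true, if_false]; ring
    · have h' : ¬ Even n := Nat.not_even_iff_odd.2 h
      simp only [a, b, s, σ, h', Nat.even_add_one, not_false_iff, if_true, if_false]; ring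
  have ha : StrictAnti a := strictAnti_nat_of_succ_lt fun n => by
    have := hal n; linarith [hap (n+1)]
  have hbl : ∀ n, 0 < b n - b (n+1) := fun n => by
    rw [hab, hal]; exact mul_pos (by linarith [(hσb n).1]) (hap _)
  have hb : StrictAnti b := strictAnti_nat_of_succ_lt fun n => by linarith [hbl n]
  have ha0 : a 0 = 1 := by simp [a]
  have hb0 : b 0 = 1 := by simp [b, s]
  have hlim : Filter.Tendsto a Filter.atTop (nhds 0) :=
    tendsto_pow_atTop_nhds_zero_of_lt_one (by norm_num) (by norm_num)
  have hblim : Filter.Tendsto b Filter.atTop (nhds 0) := by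
    refine squeeze_zero (fun n => (hbp n).le) (g := fun n => 3 / 2 * a n) (fun n => ?_) ?_
    · exact mul_le_mul_of_nonneg_right (hs n).2 (hap n).le
    · simpa using hlim.const_mul (3/2)
  have h2a : ∀ n, 2 ^ (n+2) * a (n+1) = 2 := fun n => by
    simp only [a]
    rw [show n + 2 = (n+1) + 1 by ring, pow_succ, mul_right_comm, ← mul_pow]; norm_num
  let e : ℕ → ℝ := fun n => 1 / (n.factorial : ℝ)
  have hep : ∀ n, 0 < e n := fun n => by positivity
  let eb : ℕ → ℝ := fun n => σ n * e n
  have hebp : ∀ n, 0 < eb n := fun n => mul_pos (by linarith [(hσb n).1]) (hep n)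
  obtain ⟨g, hg, hgf, hgl, K, hK, hgL⟩ := exists_g a e ha ha0 hap
    (fun n => by rw [hal, h2a]; norm_num)
    (fun n => by
      rw [abs_of_pos (hep n)]
      exact div_le_div_of_nonneg_right (by norm_num) (by positivity))
  obtain ⟨gb, hgb, hgbf, hgbl, Kb, hKb, hgbL⟩ := exists_g b eb hb hb0 hbp
    (fun n => by
      rw [hab, hal]
      have := (hσb n).1
      have h3 := mul_le_mul_of_nonneg_right this (show (0:ℝ) ≤ 2 by norm_num)
      rw [mul_left_comm, h2a]; linarith)
    (fun n => by
      rw [abs_of_pos (hebp n)]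
      have := mul_le_mul_of_nonneg_right (hσb n).2 (hep n).le
      calc eb n ≤ 2 * e n := this
        _ = _ := by simp only [e]; ring)
  obtain ⟨φ, hφ0, hφc, hφl, hφL⟩ := exists_phi a b σ ha ha0 hap hlim hblim (fun n => rfl) hab
  let δ : ℝ := 1 / (K + Kb + 1)
  have hδ : 0 < δ := by positivity
  have hδ1 : δ * (K + Kb + 1) = 1 := by simp only [δ]; field_simp
  let f : ℝ → ℝ := fun x => x + δ * g x
  let fb : ℝ → ℝ := fun x => x + δ * gb x
  obtain ⟨f1, f2, f3, f4, f5, f6, f7, f8, f9⟩ := f_props a e ha ha0 hlim hep g hg hgf hgl K δ hK hgL hδ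
    (by nlinarith) f rfl
  obtain ⟨k1, k2, k3, k4, k5, k6, k7, k8, k9⟩ := f_props b eb hb hb0 hblim hebp gb hgb hgbf hgbl Kb δ
    hKb hgbL hδ (by nlinarith) fb rfl
  have hφm : StrictMono φ := fun x y hxy => by
    have := (hφL x y hxy.le).1; linarith
  have hφ1 : φ 1 = 1 := by
    have h := hφl 0 (a 0) ⟨(ha (Nat.lt_succ_self 0)).le, le_rfl⟩
    have h2 := hab 0
    rw [← h2, ha0, hb0] at h
    rw [h]; ring
  refine ⟨f, fb, φ, f1, k1, f2, f3, k2, k3, f4, k4, f5, k5, f6, f7, k6, k7,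
    fun m hm => ⟨(f8 m hm).1, (f8 m hm).2, (k8 m hm).1, (k8 m hm).2⟩, hφc.continuousOn,
    hφm.strictMonoOn _, hφ0, hφ1, ?_, ⟨2, by norm_num, ?_⟩, ?_, ?_⟩
  · apply Set.Subset.antisymm
    · rintro _ ⟨x, hx, rfl⟩
      have h01 := hφm.monotone hx.1
      have h02 := hφm.monotone hx.2
      rw [hφ0] at h01
      rw [hφ1] at h02
      exact ⟨h01, h02⟩
    · have := intermediate_value_Icc (zero_le_one (α := ℝ)) hφc.continuousOn
      rwa [hφ0, hφ1] at this
  · have key : ∀ x y, x ≤ y → (2:ℝ)⁻¹ * |x - y| ≤ |φ x - φ y| ∧ |φ x - φ y| ≤ 2 * |x - y| := by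
      intro x y hxy
      have h := hφL x y hxy
      rw [abs_sub_comm, abs_sub_comm (φ x), abs_of_nonneg (sub_nonneg.2 hxy),
        abs_of_nonneg (sub_nonneg.2 (hφm.monotone hxy))]
      exact ⟨by linarith [h.1], h.2⟩
    intro x _ y _
    rcases le_total x y with h | h
    · exact key x y h
    · rw [abs_sub_comm, abs_sub_comm (φ x)]; exact key y x h
  · intro x hx
    rcases hx.1.eq_or_lt with h | h
    · rw [← h, f2, hφ0, k2]
    obtain ⟨n, hn1, hn2⟩ := cover a ha0 hlim h hx.2
    have ha1 : ∀ n, a n ≤ 1 := fun n => ha0 ▸ ha.antitone (Nat.zero_le n)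
    have haI : ∀ n, a n ∈ Set.Icc (0:ℝ) 1 := fun n => ⟨(hap n).le, ha1 n⟩
    have hfa : ∀ n, f (a n) = a n := fun n => (f9 _ ⟨hap n, ha1 n⟩).2 ⟨n, rfl⟩
    have hfx : f x ∈ Set.Icc (a (n+1)) (a n) := by
      have u1 := f4.monotoneOn (haI (n+1)) hx hn1.le
      have u2 := f4.monotoneOn hx (haI n) hn2
      rw [hfa] at u1 u2
      exact ⟨u1, u2⟩
    have hxI : x ∈ Set.Icc (a (n+1)) (a n) := ⟨hn1.le, hn2⟩
    have hlp : 0 < a n - a (n+1) := by rw [hal]; exact hap _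
    have hσp : 0 < σ n := by linarith [(hσb n).1]
    have hφx := hφl n x hxI
    have hφI : φ x ∈ Set.Icc (b (n+1)) (b n) := by
      have u1 := mul_nonneg hσp.le (sub_nonneg.2 hn1.le)
      have u2 := mul_le_mul_of_nonneg_left (sub_le_sub_right hn2 (a (n+1))) hσp.le
      exact ⟨by linarith, by linarith [hab n]⟩
    have ht : (φ x - b (n+1)) / (b n - b (n+1)) = (x - a (n+1)) / (a n - a (n+1)) := by
      rw [hφx, hab, add_sub_cancel_left, mul_div_mul_left _ _ hσp.ne']
    rw [hφl n _ hfx]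
    change b (n+1) + σ n * (x + δ * g x - a (n+1)) = φ x + δ * gb (φ x)
    rw [hgl n x hxI, hgbl n _ hφI, ht, hφx]
    simp only [eb]
    ring
  · rintro ⟨ψ, hψd, hψm, hψ0, hψ1, hψi, -, hψc⟩
    have hψ := no_conj a b f fb ψ ha hb hap hbp ha0 hb0 f9 k9 f5 hψm hψ0 hψi hψc
    have h0I : (0:ℝ) ∈ Set.Icc (0:ℝ) 1 := Set.left_mem_Icc.2 zero_le_one
    have hd := ((hψd.differentiableOn (by norm_num)) 0 h0I).hasDerivWithinAt
    rw [hasDerivWithinAt_iff_tendsto_slope] at hd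
    have ht : Filter.Tendsto a Filter.atTop (nhdsWithin 0 (Set.Icc 0 1 \ {0})) := by
      refine tendsto_nhdsWithin_iff.2 ⟨hlim, Filter.Eventually.of_forall fun n => ?_⟩
      exact ⟨⟨(hap n).le, ha0 ▸ ha.antitone (Nat.zero_le n)⟩, (hap n).ne'⟩
    have h1 := hd.comp ht
    have h2 : (slope ψ 0 ∘ a) = s := by
      funext n
      simp only [Function.comp, slope_def_field, hψ, hψ0, sub_zero]
      exact mul_div_cancel_right₀ _ (hap n).ne'
    rw [h2] at h1
    have e1 := h1.comp (Filter.tendsto_atTop_mono (f := id) (g := fun n : ℕ => 2 * n)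
      (fun n => by simp only [id]; omega) Filter.tendsto_id)
    have e2 := h1.comp (Filter.tendsto_atTop_mono (f := id) (g := fun n : ℕ => 2 * n + 1)
      (fun n => by simp only [id]; omega) Filter.tendsto_id)
    have e3 : (s ∘ fun n : ℕ => 2 * n) = fun _ => (1:ℝ) := by
      funext n; simp [s]
    have e4 : (s ∘ fun n : ℕ => 2 * n + 1) = fun _ => (3/2:ℝ) := by
      funext n; simp [s, Nat.even_add_one]
    rw [e3] at e1
    rw [e4] at e2
    have r1 := tendsto_nhds_unique e1 tendsto_const_nhds
    have r2 := tendsto_nhds_unique e2 tendsto_const_nhds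
    linarith
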